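/- arXiv:2106.14389 — 3 statements merged into one kernel-verified Lean document; each statement's English description precedes it below -/
import Mathlib

section
/- Let (p_i)_{i≥0} be nonnegative reals with ∑_{i≥0} p_i = 1, p_0 ∈ (0,1), and mean ∑_{i≥0} i·p_i ≤ 1, and let f(s) = ∑_{i≥0} p_i s^i for s ∈ [0,1]. Then the equation q = f(1−q) has exactly one solution q in the interval [0,1], and this solution satisfies 1/2 < q < 1. -/
theorem summable_mul_pow_of_mem_Icc {p : ℕ → ℝ} (hp : ∀ i, 0 ≤ p i) (hs : Summable p)
    {s : ℝ} (h : s ∈ Set.Icc (0 : ℝ) 1) : Summable fun i => p i * s ^ i :=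
  hs.of_nonneg_of_le (fun i => mul_nonneg (hp i) (pow_nonneg h.1 i))
    fun i => mul_le_of_le_one_right (hp i) (pow_le_one₀ h.1 h.2)

theorem monotoneOn_tsum_mul_pow {p : ℕ → ℝ} (hp : ∀ i, 0 ≤ p i) (hs : Summable p) :
    MonotoneOn (fun s : ℝ => ∑' i, p i * s ^ i) (Set.Icc 0 1) := fun _ hx _ hy hxy =>
  (summable_mul_pow_of_mem_Icc hp hs hx).tsum_le_tsum
    (fun i => mul_le_mul_of_nonneg_left (pow_le_pow_left₀ hx.1 hxy i) (hp i))
    (summable_mul_pow_of_mem_Icc hp hs hy)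

theorem continuousOn_tsum_mul_pow {p : ℕ → ℝ} (hp : ∀ i, 0 ≤ p i) (hs : Summable p) :
    ContinuousOn (fun s : ℝ => ∑' i, p i * s ^ i) (Set.Icc 0 1) := by
  refine continuousOn_tsum (fun i => by fun_prop) hs fun i s h => ?_
  rw [Real.norm_of_nonneg (mul_nonneg (hp i) (pow_nonneg h.1 i))]
  exact mul_le_of_le_one_right (hp i) (pow_le_one₀ h.1 h.2)

/-- A chord bound for `2⁻ⁱ` through `i = 1, 2`, sharpened to equality at `i = 0`. -/
theorem chord_le_half_pow (i : ℕ) :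
    3 / 4 - (i : ℝ) / 4 + (if i = 0 then 1 / 4 else 0) ≤ (1 / 2 : ℝ) ^ i := by
  match i with
  | 0 => norm_num
  | 1 => norm_num
  | 2 => norm_num
  | n + 3 =>
    have : (0 : ℝ) ≤ (1 / 2 : ℝ) ^ (n + 3) := by positivity
    have : (0 : ℝ) ≤ n := n.cast_nonneg
    simp only [Nat.add_eq_zero_iff, OfNat.ofNat_ne_zero, and_false, if_false]
    push_cast
    linarith

/-- The generating function of a subcritical or critical offspring distribution at `1/2`. -/
theorem half_add_le_tsum_mul_half_pow {p : ℕ → ℝ} (hp : ∀ i, 0 ≤ p i) (hsum : HasSum p 1)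
    (hm : Summable fun i : ℕ => (i : ℝ) * p i) (hmean : ∑' i : ℕ, (i : ℝ) * p i ≤ 1) :
    1 / 2 + p 0 / 4 ≤ ∑' i, p i * (1 / 2 : ℝ) ^ i := by
  have h := ((hsum.mul_left (3 / 4)).sub (hm.hasSum.mul_left (1 / 4))).add
    (hasSum_ite_eq 0 (p 0 / 4))
  have hle := hasSum_le (fun i => ?_) h
    (summable_mul_pow_of_mem_Icc hp hsum.summable (s := 1 / 2) (by norm_num)).hasSum
  · linarith
  · refine le_of_eq_of_le ?_ (mul_le_mul_of_nonneg_left (chord_le_half_pow i) (hp i))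
    split_ifs with hi
    · subst hi; ring
    · ring


/-- For an offspring distribution `(p i)` with `p 0 ∈ (0,1)` and mean at most 1,
the equation `q = f (1 - q)` (where `f` is the probability generating function) has exactly
one solution `q ∈ [0,1]`, and it satisfies `1/2 < q < 1`. -/
theorem layered_independent_set_fixed_point
    (p : ℕ → ℝ) (hp : ∀ i, 0 ≤ p i) (hsum : ∑' i, p i = 1)
    (hp0 : p 0 ∈ Set.Ioo (0 : ℝ) 1)
    (hmean_summable : Summable (fun i : ℕ => (i : ℝ) * p i))
    (hmean : ∑' i : ℕ, (i : ℝ) * p i ≤ 1)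
    (f : ℝ → ℝ) (hf : ∀ s ∈ Set.Icc (0 : ℝ) 1, f s = ∑' i, p i * s ^ i) :
    (∃! q : ℝ, q ∈ Set.Icc (0 : ℝ) 1 ∧ q = f (1 - q)) ∧
      (∀ q : ℝ, q ∈ Set.Icc (0 : ℝ) 1 → q = f (1 - q) → q ∈ Set.Ioo (1 / 2 : ℝ) 1) := by
  have hasSum_p : HasSum p 1 := by
    have hs : Summable p := by
      by_contra h
      simp [tsum_eq_zero_of_not_summable h] at hsum
    exact hsum ▸ hs.hasSum
  have hs := hasSum_p.summable
  have hmono : MonotoneOn f (Set.Icc 0 1) := (monotoneOn_tsum_mul_pow hp hs).congr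
    fun s h => (hf s h).symm
  have hcont : ContinuousOn f (Set.Icc 0 1) := (continuousOn_tsum_mul_pow hp hs).congr hf
  have h_one : f 1 = 1 := by simp [hf 1 (by simp), hsum]
  have h_zero : f 0 = p 0 := by
    rw [hf 0 (by simp), tsum_eq_single 0 fun i hi => by simp [hi]]
    simp
  have h_half : 1 / 2 < f (1 / 2) := by
    have := half_add_le_tsum_mul_half_pow hp hasSum_p hmean_summable hmean
    rw [hf (1 / 2) (by norm_num)]
    linarith [hp0.1]
  have hmaps : Set.MapsTo (fun q : ℝ => 1 - q) (Set.Icc 0 1) (Set.Icc 0 1) := fun q hq =>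
    ⟨by linarith [hq.2], by linarith [hq.1]⟩
  have hunique : ∀ x ∈ Set.Icc (0 : ℝ) 1, x = f (1 - x) → ∀ y ∈ Set.Icc (0 : ℝ) 1,
      y = f (1 - y) → x ≤ y := by
    intro x hx hfx y hy hfy
    by_contra! hlt
    linarith [hmono (hmaps hx) (hmaps hy) (by linarith)]
  constructor
  · have hg : ContinuousOn (fun q : ℝ => q - f (1 - q)) (Set.Icc 0 1) :=
      continuousOn_id.sub (hcont.comp (by fun_prop) hmaps)
    obtain ⟨q, hq, hq0⟩ := intermediate_value_Icc zero_le_one hg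
      (show (0 : ℝ) ∈ _ by
        simp only [sub_zero, sub_self, h_one, h_zero]
        exact ⟨by norm_num, by linarith [hp0.2]⟩)
    have hfq : q = f (1 - q) := sub_eq_zero.mp hq0
    exact ⟨q, ⟨hq, hfq⟩, fun y hy =>
      le_antisymm (hunique y hy.1 hy.2 q hq hfq) (hunique q hq hfq y hy.1 hy.2)⟩
  · intro q hq hfq
    constructor
    · by_contra! hle
      linarith [hmono (by norm_num : (1 / 2 : ℝ) ∈ Set.Icc 0 1) (hmaps hq) (by linarith)]
    · refine lt_of_le_of_ne hq.2 fun h => ?_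
      rw [h, sub_self, h_zero] at hfq
      exact hp0.2.ne hfq.symm
end

section
/- Let (p_i)_{i≥0} be nonnegative reals with ∑_{i≥0} p_i = 1, p_0 ∈ (0,1), p_1 = 0, and mean ∑_{i≥0} i·p_i = 1, and let f(s) = ∑_{i≥0} p_i s^i. Let κ be the least integer i ≥ 2 with p_i > 0. Define the sequence (ℓ_i)_{i≥0} by ℓ_0 = p_0, ℓ_1 = 1 − f(1−p_0), and ℓ_{i+1} = f(1 − ∑_{j=0}^{i−1} ℓ_j) − f(1 − ∑_{j=0}^{i} ℓ_j) for i ≥ 1. Then ℓ_i > 0 for all i and there exist constants c > 0, C > 0 and N such that for all i ≥ N, exp(−C·κ^i) ≤ ℓ_i ≤ exp(−c·κ^i); that is, log ℓ_i = Θ(−κ^i) as i → ∞. -/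
/-- The generating function of an offspring distribution whose positive indices are supported
on `[κ, ∞)` is pinched between two multiples of `s ^ κ`, up to the constant `p 0`. -/
theorem tsum_mul_pow_bounds {p : ℕ → ℝ} (hp : ∀ i, 0 ≤ p i) (hsum : HasSum p 1) {κ : ℕ}
    (hκ0 : κ ≠ 0) (hκ : ∀ i, i ≠ 0 → i < κ → p i = 0) {s : ℝ} (hs : s ∈ Set.Icc (0 : ℝ) 1) :
    p κ * s ^ κ ≤ ∑' i, p i * s ^ i - p 0 ∧
      ∑' i, p i * s ^ i - p 0 ≤ (1 - p 0) * s ^ κ := by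
  obtain ⟨hs0, hs1⟩ := hs
  have hnonneg : ∀ i, 0 ≤ p i * s ^ i := fun i => mul_nonneg (hp i) (pow_nonneg hs0 i)
  have hsummable : Summable fun i => p i * s ^ i :=
    hsum.summable.of_nonneg_of_le hnonneg
      fun i => mul_le_of_le_one_right (hp i) (pow_le_one₀ hs0 hs1)
  constructor
  · have h := hsummable.sum_le_tsum {0, κ} fun i _ => hnonneg i
    rw [Finset.sum_pair hκ0.symm, pow_zero, mul_one] at h
    linarith
  · have hbound : HasSum (fun i => p i * s ^ κ + if i = 0 then p 0 * (1 - s ^ κ) else 0)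
        (1 * s ^ κ + p 0 * (1 - s ^ κ)) :=
      (hsum.mul_right _).add (hasSum_ite_eq 0 _)
    have h := hasSum_le (fun i => ?_) hsummable.hasSum hbound
    · linarith
    · rcases eq_or_ne i 0 with rfl | hi
      · simp only [pow_zero, if_true]
        linarith
      · rw [if_neg hi, add_zero]
        rcases lt_or_ge i κ with hlt | hge
        · simp [hκ i hi hlt]
        · exact mul_le_mul_of_nonneg_left (pow_le_pow_of_le_one hs0 hs1 hge) (hp i)

/-- Iterating `a * x ^ κ ≤ x'` with `κ ≥ 2` loses at most a factor `a ^ (κ ^ i)`. -/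
theorem pow_pow_le_of_mul_pow_le {T : ℕ → ℝ} {a : ℝ} {κ : ℕ} (ha0 : 0 < a) (ha1 : a ≤ 1)
    (hκ : 2 ≤ κ) (hT0 : T 0 = 1) (hT : ∀ i, 0 ≤ T i) (h : ∀ i, a * T i ^ κ ≤ T (i + 1)) (i : ℕ) :
    a ^ κ ^ i ≤ a * T i := by
  induction i with
  | zero => simp [hT0]
  | succ i ih =>
    calc a ^ κ ^ (i + 1) = (a ^ κ ^ i) ^ κ := by rw [pow_succ, pow_mul]
      _ ≤ (a * T i) ^ κ := by gcongr
      _ = a ^ κ * T i ^ κ := mul_pow ..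
      _ ≤ a ^ 2 * T i ^ κ :=
        mul_le_mul_of_nonneg_right (pow_le_pow_of_le_one ha0.le ha1 hκ) (pow_nonneg (hT i) κ)
      _ = a * (a * T i ^ κ) := by ring
      _ ≤ a * T (i + 1) := by gcongr; exact h i

/-- A sequence with `T 1 ≤ q` and `T (i + 1) ≤ T i ^ κ` decays doubly exponentially. -/
theorem le_pow_pow_of_le_pow {T : ℕ → ℝ} {q : ℝ} {κ : ℕ} (hT : ∀ i, 0 ≤ T i) (hT1 : T 1 ≤ q)
    (h : ∀ i, T (i + 1) ≤ T i ^ κ) (i : ℕ) : T (i + 1) ≤ q ^ κ ^ i := by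
  induction i with
  | zero => simpa using hT1
  | succ i ih =>
    calc T (i + 1 + 1) ≤ T (i + 1) ^ κ := h (i + 1)
      _ ≤ (q ^ κ ^ i) ^ κ := pow_le_pow_left₀ (hT _) ih κ
      _ = q ^ κ ^ (i + 1) := by rw [pow_succ, pow_mul]

/-- The tails of the leaf-height distribution are the iterates of `s ↦ f s - p 0`. -/
theorem leaf_height_tail_succ {f : ℝ → ℝ} {ℓ : ℕ → ℝ} (hf1 : f 1 = 1)
    (hl1 : ℓ 1 = 1 - f (1 - ℓ 0))
    (hlrec : ∀ i : ℕ, 1 ≤ i →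
      ℓ (i + 1) = f (1 - ∑ j ∈ Finset.range i, ℓ j) -
        f (1 - ∑ j ∈ Finset.range (i + 1), ℓ j)) (i : ℕ) :
    1 - ∑ j ∈ Finset.range (i + 1), ℓ j = f (1 - ∑ j ∈ Finset.range i, ℓ j) - ℓ 0 := by
  induction i with
  | zero => simp [hf1]
  | succ i ih =>
    rw [Finset.sum_range_succ]
    rcases Nat.eq_zero_or_pos i with rfl | hi
    · simp [hl1]
      ring
    · linarith [hlrec i hi]

/-- For a critical offspring distribution with `p 0 ∈ (0,1)`, `p 1 = 0`,
and `κ` the least index `≥ 2` with `p κ > 0`, the leaf-height distribution `(ℓ i)`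
satisfies `ℓ i > 0` and `log ℓ i = Θ(-κ^i)`: eventually
`exp(-C κ^i) ≤ ℓ i ≤ exp(-c κ^i)` for some constants `c, C > 0`. -/
theorem leaf_height_distribution_asymptotics_p1_zero
    (p : ℕ → ℝ) (hp : ∀ i, 0 ≤ p i) (hsum : ∑' i, p i = 1)
    (hp0 : p 0 ∈ Set.Ioo (0 : ℝ) 1) (hp1 : p 1 = 0)
    (hmean_summable : Summable (fun i : ℕ => (i : ℝ) * p i))
    (hmean : ∑' i : ℕ, (i : ℝ) * p i = 1)
    (κ : ℕ) (hκ : IsLeast {i : ℕ | 2 ≤ i ∧ 0 < p i} κ)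
    (f : ℝ → ℝ) (hf : ∀ s ∈ Set.Icc (0 : ℝ) 1, f s = ∑' i, p i * s ^ i)
    (ℓ : ℕ → ℝ)
    (hl0 : ℓ 0 = p 0)
    (hl1 : ℓ 1 = 1 - f (1 - p 0))
    (hlrec : ∀ i : ℕ, 1 ≤ i →
      ℓ (i + 1) = f (1 - ∑ j ∈ Finset.range i, ℓ j) -
        f (1 - ∑ j ∈ Finset.range (i + 1), ℓ j)) :
    (∀ i, 0 < ℓ i) ∧
      ∃ c > (0 : ℝ), ∃ C > (0 : ℝ), ∃ N : ℕ, ∀ i : ℕ, N ≤ i →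
        Real.exp (-C * (κ : ℝ) ^ i) ≤ ℓ i ∧ ℓ i ≤ Real.exp (-c * (κ : ℝ) ^ i) := by
  obtain ⟨hq0, hq1⟩ := hp0
  obtain ⟨⟨hκ2, hpκ⟩, hκmin⟩ := hκ
  have hκ0 : κ ≠ 0 := by omega
  have hsummable : Summable p := by
    by_contra hns
    simp [tsum_eq_zero_of_not_summable hns] at hsum
  have hasSum : HasSum p 1 := hsum ▸ hsummable.hasSum
  have hvanish : ∀ i, i ≠ 0 → i < κ → p i = 0 := by
    intro i hi hlt
    rcases eq_or_ne i 1 with rfl | hi1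
    · exact hp1
    · by_contra hne
      have := hκmin ⟨by omega, (hp i).lt_of_ne (Ne.symm hne)⟩
      omega
  have hf1 : f 1 = 1 := by simp [hf 1 (by simp), hsum]
  set T : ℕ → ℝ := fun i => 1 - ∑ j ∈ Finset.range i, ℓ j with hTdef
  have hT0 : T 0 = 1 := by simp [hTdef]
  have hT1 : T 1 = 1 - p 0 := by simp [hTdef, hl0]
  have hTstep : ∀ i, T (i + 1) = f (T i) - p 0 := fun i => by
    rw [← hl0]
    exact leaf_height_tail_succ hf1 (hl0.symm ▸ hl1) hlrec i
  have hℓT : ∀ i, ℓ i = T i - T (i + 1) := fun i => by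
    simp only [hTdef, Finset.sum_range_succ]
    ring
  have hbounds : ∀ i, T i ∈ Set.Icc (0 : ℝ) 1 →
      p κ * T i ^ κ ≤ T (i + 1) ∧ T (i + 1) ≤ (1 - p 0) * T i ^ κ := fun i hi => by
    rw [hTstep, hf _ hi]
    exact tsum_mul_pow_bounds hp hasSum hκ0 hvanish hi
  have hTmem : ∀ i, 0 < T i ∧ T i ≤ 1 := by
    intro i
    induction i with
    | zero => simp [hT0]
    | succ i ih =>
      obtain ⟨hlow, hupp⟩ := hbounds i ⟨ih.1.le, ih.2⟩
      exact ⟨(mul_pos hpκ (pow_pos ih.1 κ)).trans_le hlow,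
        hupp.trans (mul_le_one₀ (by linarith) (pow_nonneg ih.1.le κ) (pow_le_one₀ ih.1.le ih.2))⟩
  have hlow : ∀ i, p κ * T i ^ κ ≤ T (i + 1) := fun i =>
    (hbounds i ⟨(hTmem i).1.le, (hTmem i).2⟩).1
  have hupp : ∀ i, T (i + 1) ≤ (1 - p 0) * T i ^ κ := fun i =>
    (hbounds i ⟨(hTmem i).1.le, (hTmem i).2⟩).2
  have hℓlow : ∀ i, p 0 * T i ≤ ℓ i := fun i => by
    have h := mul_le_mul_of_nonneg_left (pow_le_of_le_one (hTmem i).1.le (hTmem i).2 hκ0)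
      (sub_nonneg.2 hq1.le)
    rw [hℓT]
    linarith [hupp i]
  have hpκ1 : p κ ≤ 1 := le_hasSum hasSum κ fun i _ => hp i
  have hTlow : ∀ i, p κ ^ κ ^ i ≤ T i := fun i =>
    (pow_pow_le_of_mul_pow_le hpκ hpκ1 hκ2 hT0 (fun i => (hTmem i).1.le) hlow i).trans
      (mul_le_of_le_one_left (hTmem i).1.le hpκ1)
  have hTupp : ∀ i, T (i + 1) ≤ (1 - p 0) ^ κ ^ i :=
    le_pow_pow_of_le_pow (fun i => (hTmem i).1.le) hT1.le fun i =>
      (hupp i).trans (mul_le_of_le_one_left (pow_nonneg (hTmem i).1.le κ) (by linarith))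
  have hexp : ∀ {x : ℝ} (n : ℕ), 0 < x → Real.exp (Real.log x * n) = x ^ n := fun n hx => by
    rw [mul_comm, Real.exp_nat_mul, Real.exp_log hx]
  have hκpos : (0 : ℝ) < κ := by positivity
  have hprod : 0 < p 0 * p κ := mul_pos hq0 hpκ
  refine ⟨fun i => (mul_pos hq0 (hTmem i).1).trans_le (hℓlow i),
    -Real.log (1 - p 0) / κ, div_pos (neg_pos.2 (Real.log_neg (by linarith) (by linarith))) hκpos,
    -Real.log (p 0 * p κ), neg_pos.2 (Real.log_neg hprod
      (mul_lt_one_of_nonneg_of_lt_one_left hq0.le hq1 hpκ1)), 1, fun i hi => ⟨?_, ?_⟩⟩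
  · rw [neg_neg, ← Nat.cast_pow, hexp _ hprod, mul_pow]
    refine le_trans ?_ (hℓlow i)
    exact mul_le_mul (pow_le_of_le_one hq0.le hq1.le (pow_ne_zero i hκ0)) (hTlow i)
      (pow_nonneg hpκ.le _) hq0.le
  · obtain ⟨i, rfl⟩ := Nat.exists_eq_add_of_le' hi
    have hrw : -(-Real.log (1 - p 0) / κ) * (κ : ℝ) ^ (i + 1) =
        Real.log (1 - p 0) * (κ ^ i : ℕ) := by
      push_cast
      field_simp
      ring
    rw [hrw, hexp _ (by linarith)]
    linarith [hℓT (i + 1), (hTmem (i + 1 + 1)).1, hTupp i]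
end

section
/- Let (p_i)_{i≥0} be nonnegative reals with ∑_{i≥0} p_i = 1, p_0 ∈ (0,1), and mean ∑_{i≥0} i·p_i ≤ 1, and let f(s) = ∑_{i≥0} p_i s^i. Define the sequence (ℓ_i)_{i≥0} by ℓ_0 = p_0, ℓ_1 = 1 − f(1−p_0), and ℓ_{i+1} = f(1 − ∑_{j=0}^{i−1} ℓ_j) − f(1 − ∑_{j=0}^{i} ℓ_j) for i ≥ 1. Then for all i ≥ 1, the tail quantity u_i := 1 − ∑_{j=0}^{i−1} ℓ_j satisfies u_{i+1} = f(u_i) − p_0; moreover 0 ≤ u_{i+1} ≤ u_i ≤ 1 for all i ≥ 1. -/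
/-- For the leaf-height distribution `(ℓ i)`, the tail quantities
`u i = 1 - ∑_{j<i} ℓ j` satisfy `u (i+1) = f (u i) - p 0` for `i ≥ 1`, and
`0 ≤ u (i+1) ≤ u i ≤ 1` for all `i ≥ 1`. -/
theorem leaf_height_tail_recursion
    (p : ℕ → ℝ) (hp : ∀ i, 0 ≤ p i) (hsum : ∑' i, p i = 1)
    (hp0 : p 0 ∈ Set.Ioo (0 : ℝ) 1)
    (hmean_summable : Summable (fun i : ℕ => (i : ℝ) * p i))
    (hmean : ∑' i : ℕ, (i : ℝ) * p i ≤ 1)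
    (f : ℝ → ℝ) (hf : ∀ s ∈ Set.Icc (0 : ℝ) 1, f s = ∑' i, p i * s ^ i)
    (ℓ : ℕ → ℝ)
    (hl0 : ℓ 0 = p 0)
    (hl1 : ℓ 1 = 1 - f (1 - p 0))
    (hlrec : ∀ i : ℕ, 1 ≤ i →
      ℓ (i + 1) = f (1 - ∑ j ∈ Finset.range i, ℓ j) -
        f (1 - ∑ j ∈ Finset.range (i + 1), ℓ j))
    (u : ℕ → ℝ) (hu : ∀ i : ℕ, u i = 1 - ∑ j ∈ Finset.range i, ℓ j) :
    ∀ i : ℕ, 1 ≤ i →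
      u (i + 1) = f (u i) - p 0 ∧ 0 ≤ u (i + 1) ∧ u (i + 1) ≤ u i ∧ u i ≤ 1 := by
  have hs : Summable p := by
    by_contra h
    simp [tsum_eq_zero_of_not_summable h] at hsum
  have hmono : MonotoneOn f (Set.Icc 0 1) :=
    (monotoneOn_tsum_mul_pow hp hs).congr fun s h => (hf s h).symm
  have hf1 : f 1 = 1 := by simp [hf 1 (by simp), hsum]
  have hf0 : f 0 = p 0 := by
    rw [hf 0 (by simp), tsum_eq_single 0 fun i hi => by simp [hi]]
    simp
  have hu1 : u 1 = 1 - p 0 := by simp [hu, hl0]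
  have hsucc (i : ℕ) : u (i + 1) = u i - ℓ i := by
    rw [hu, hu, Finset.sum_range_succ]
    ring
  have hrec (i : ℕ) (hi : 1 ≤ i) : u (i + 1) = f (u i) - p 0 := by
    induction i, hi using Nat.le_induction with
    | base => rw [hsucc, hl1, hu1]; ring
    | succ i hi ih =>
      rw [hsucc, hlrec i hi, ← hu, ← hu]
      linarith
  have hnonneg {i : ℕ} (hi : 1 ≤ i) (h : u i ∈ Set.Icc (0 : ℝ) 1) : 0 ≤ u (i + 1) := by
    have := hmono (by simp) h h.1
    linarith [hrec i hi]
  intro i hi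
  refine ⟨hrec i hi, ?_⟩
  induction i, hi using Nat.le_induction with
  | base =>
    have h : u 1 ∈ Set.Icc (0 : ℝ) 1 := by
      constructor <;> linarith [hp0.1, hp0.2]
    have := hmono h (by simp) h.2
    exact ⟨hnonneg le_rfl h, by linarith [hrec 1 le_rfl], h.2⟩
  | succ i hi ih =>
    obtain ⟨h0, hle, h1⟩ := ih
    have h : u (i + 1) ∈ Set.Icc (0 : ℝ) 1 := ⟨h0, hle.trans h1⟩
    have := hmono h ⟨h0.trans hle, h1⟩ hle
    exact ⟨hnonneg (by lia) h, by linarith [hrec i hi, hrec (i + 1) (by lia)], h.2⟩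
end
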